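/- Assume that μ is a finite measure and that f is injective. Then the composition operator T_f on L^p(X,𝓑,μ) is densely Li-Yorke chaotic if and only if it is topologically transitive. -/

import Mathlib

open MeasureTheory Filter Set Topology
open scoped ENNReal

noncomputable section

/-- A continuous self-map `g` of a metric space is *Li-Yorke chaotic* if there is an
uncountable set `S` (a scrambled set) such that every pair of distinct points `x, y ∈ S`
satisfies `liminf dist (gⁿ x) (gⁿ y) = 0` and `limsup dist (gⁿ x) (gⁿ y) > 0`. -/
def LiYorkeChaotic {M : Type*} [PseudoMetricSpace M] (g : M → M) : Prop :=
  ∃ S : Set M, ¬ S.Countable ∧ ∀ x ∈ S, ∀ y ∈ S, x ≠ y →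
    (∀ ε > 0, ∃ᶠ n in atTop, dist (g^[n] x) (g^[n] y) < ε) ∧
    (∃ ε > 0, ∃ᶠ n in atTop, ε < dist (g^[n] x) (g^[n] y))

/-- The set of points lying outside `B l` for some `l ≥ j`. -/
def tailCompl {X : Type*} (B : ℕ → Set X) (j : ℕ) : Set X :=
  ⋃ l, (B (j + l))ᶜ

theorem compl_subset_tailCompl {X : Type*} (B : ℕ → Set X) {j l : ℕ} (h : j ≤ l) :
    (B l)ᶜ ⊆ tailCompl B j := by
  obtain ⟨k, rfl⟩ := Nat.exists_eq_add_of_le h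
  exact subset_iUnion (fun k => (B (j + k))ᶜ) k

theorem measurableSet_tailCompl {X : Type*} [MeasurableSpace X] {B : ℕ → Set X}
    (hB : ∀ j, MeasurableSet (B j)) (j : ℕ) : MeasurableSet (tailCompl B j) :=
  MeasurableSet.iUnion fun _ => (hB _).compl

/-- `f` is *almost expelling*: sets of almost full measure are moved, by some iterate of `f`,
so that their preimage is almost null. -/
def AlmostExpelling {X : Type*} [MeasurableSpace X] (μ : Measure X) (f : X → X) : Prop :=
  ∀ ε : ℝ≥0∞, ε ≠ 0 → ∃ (n : ℕ) (B : Set X),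
    MeasurableSet B ∧ μ Bᶜ ≤ ε ∧ μ (f^[n] ⁻¹' B) ≤ ε

/-- A sequence of times `n` and sets `B` along which `f` is almost expelling, with uniform control
on the tails. -/
structure IsExpellingSequence {X : Type*} [MeasurableSpace X] (μ : Measure X) (f : X → X)
    (n : ℕ → ℕ) (B : ℕ → Set X) : Prop where
  tendsto_atTop : Tendsto n atTop atTop
  measurableSet : ∀ j, MeasurableSet (B j)
  tendsto_tail : Tendsto (fun j => μ (tailCompl B j)) atTop (𝓝 0)
  tendsto_preimage :
    Tendsto (fun j => μ (f^[n j] ⁻¹' (B j ∪ tailCompl B (j + 1)))) atTop (𝓝 0)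

section Dynamics

variable {X : Type*} [MeasurableSpace X] {μ : Measure X} {f : X → X} {c : ℝ≥0∞}

theorem pow_mul_measure_preimage_iterate_le (hf : Measurable f)
    (hcf : ∀ A, MeasurableSet A → c * μ (f ⁻¹' A) ≤ μ A) (n : ℕ) {A : Set X}
    (hA : MeasurableSet A) : c ^ n * μ (f^[n] ⁻¹' A) ≤ μ A := by
  induction n with
  | zero => simp
  | succ n ih =>
    calc c ^ (n + 1) * μ (f^[n + 1] ⁻¹' A)
        = c ^ n * (c * μ (f ⁻¹' (f^[n] ⁻¹' A))) := by
          rw [Function.iterate_succ, preimage_comp, pow_succ, mul_assoc]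
      _ ≤ c ^ n * μ (f^[n] ⁻¹' A) := by
          gcongr
          exact hcf _ (hf.iterate n hA)
      _ ≤ μ A := ih

theorem quasiMeasurePreserving_of_mul_measure_preimage_le (hf : Measurable f) (hc : c ≠ 0)
    (hcf : ∀ A, MeasurableSet A → c * μ (f ⁻¹' A) ≤ μ A) :
    Measure.QuasiMeasurePreserving f μ μ := by
  refine ⟨hf, Measure.AbsolutelyContinuous.mk fun A hA h => ?_⟩
  rw [Measure.map_apply hf hA]
  have := hcf A hA
  rw [h, nonpos_iff_eq_zero, mul_eq_zero] at this
  exact this.resolve_left hc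

variable [IsFiniteMeasure μ]

theorem AlmostExpelling.exists_gt (h : AlmostExpelling μ f) (hX : μ univ ≠ 0) (hf : Measurable f)
    (hc : c ≠ 0) (hc1 : c ≤ 1) (hcf : ∀ A, MeasurableSet A → c * μ (f ⁻¹' A) ≤ μ A)
    (N : ℕ) {ε : ℝ≥0∞} (hε : ε ≠ 0) :
    ∃ (n : ℕ) (B : Set X), N < n ∧ MeasurableSet B ∧ μ Bᶜ ≤ ε ∧ μ (f^[n] ⁻¹' B) ≤ ε := by
  have hcN : c ^ N ≠ 0 := pow_ne_zero _ hc
  have hδ : c ^ N * (μ univ / 4) ≠ 0 :=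
    mul_ne_zero hcN (ENNReal.div_pos hX (by simp)).ne'
  obtain ⟨n, B, hB, h1, h2⟩ := h (min ε (c ^ N * (μ univ / 4)))
    (by simp only [ne_eq, min_eq_iff, not_or]; grind)
  refine ⟨n, B, ?_, hB, h1.trans (min_le_left _ _), h2.trans (min_le_left _ _)⟩
  by_contra! hn
  have hcN_top : c ^ N ≠ ∞ := ENNReal.pow_ne_top (ne_top_of_le_ne_top ENNReal.one_ne_top hc1)
  have h3 : μ (f^[n] ⁻¹' Bᶜ) ≤ μ univ / 4 := by
    rw [← ENNReal.mul_le_mul_iff_right hcN hcN_top]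
    calc c ^ N * μ (f^[n] ⁻¹' Bᶜ) ≤ c ^ n * μ (f^[n] ⁻¹' Bᶜ) := by
          gcongr ?_ * _
          exact pow_le_pow_right_of_le_one' hc1 hn
      _ ≤ μ Bᶜ := pow_mul_measure_preimage_iterate_le hf hcf n hB.compl
      _ ≤ c ^ N * (μ univ / 4) := h1.trans (min_le_right _ _)
  have h4 : μ (f^[n] ⁻¹' B) ≤ μ univ / 4 :=
    (h2.trans (min_le_right _ _)).trans (mul_le_of_le_one_left' (pow_le_one' hc1 N))
  have h5 : μ univ ≤ μ univ / 4 + μ univ / 4 := by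
    calc μ univ = μ (f^[n] ⁻¹' B ∪ f^[n] ⁻¹' Bᶜ) := by rw [preimage_compl, union_compl_self]
      _ ≤ _ := (measure_union_le _ _).trans (add_le_add h4 h3)
  have hfin : μ univ ≠ ∞ := measure_ne_top _ _
  have h6 := ENNReal.toReal_mono (by finiteness) h5
  rw [ENNReal.toReal_add (by finiteness) (by finiteness), ENNReal.toReal_div] at h6
  have h7 := ENNReal.toReal_pos hX hfin
  norm_num at h6
  linarith

theorem AlmostExpelling.exists_isExpellingSequence (h : AlmostExpelling μ f) (hX : μ univ ≠ 0)
    (hf : Measurable f) (hc : c ≠ 0) (hc1 : c ≤ 1)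
    (hcf : ∀ A, MeasurableSet A → c * μ (f ⁻¹' A) ≤ μ A) :
    ∃ (n : ℕ → ℕ) (B : ℕ → Set X), IsExpellingSequence μ f n B := by
  have hstep : ∀ N j : ℕ, ∃ (n : ℕ) (B : Set X), N < n ∧ MeasurableSet B ∧
      μ Bᶜ ≤ c ^ N * 2⁻¹ ^ j ∧ μ (f^[n] ⁻¹' B) ≤ c ^ N * 2⁻¹ ^ j := fun N j =>
    h.exists_gt hX hf hc hc1 hcf N
      (mul_ne_zero (pow_ne_zero _ hc) (pow_ne_zero _ (by simp)))
  choose F G hFlt hGm hGc hGp using hstep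
  let N : ℕ → ℕ := fun j => Nat.rec 0 (fun j r => F r j) j
  have hNlt (j : ℕ) : N j < N (j + 1) := hFlt (N j) j
  have hN : StrictMono N := strictMono_nat_of_lt_succ hNlt
  let B : ℕ → Set X := fun j => G (N j) j
  have hB (j : ℕ) : MeasurableSet (B j) := hGm _ _
  have hgeo (j : ℕ) : ∑' l, (2⁻¹ : ℝ≥0∞) ^ (j + l) = 2 * 2⁻¹ ^ j := by
    simp_rw [pow_add]
    rw [ENNReal.tsum_mul_left, ENNReal.tsum_geometric_two, mul_comm]
  have hlim (k : ℝ≥0∞) (hk : k ≠ ∞) :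
      Tendsto (fun j : ℕ => k * (2⁻¹ : ℝ≥0∞) ^ j) atTop (𝓝 0) := by
    simpa using ENNReal.Tendsto.const_mul
      (ENNReal.tendsto_pow_atTop_nhds_zero_of_lt_one ENNReal.one_half_lt_one) (Or.inr hk)
  have hle (k j : ℕ) : c ^ k * (2⁻¹ : ℝ≥0∞) ^ j ≤ 2⁻¹ ^ j :=
    mul_le_of_le_one_left' (pow_le_one' hc1 k)
  refine ⟨fun j => N (j + 1), B, ⟨?_, hB, ?_, ?_⟩⟩
  · exact hN.tendsto_atTop.comp (tendsto_add_atTop_nat 1)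
  · refine tendsto_of_tendsto_of_tendsto_of_le_of_le tendsto_const_nhds (hlim 2 (by simp))
      (fun _ => zero_le) fun j => ?_
    exact (measure_iUnion_le _).trans
      ((ENNReal.tsum_le_tsum fun l => (hGc _ _).trans (hle _ _)).trans_eq (hgeo j))
  · refine tendsto_of_tendsto_of_tendsto_of_le_of_le tendsto_const_nhds (hlim 3 (by simp))
      (fun _ => zero_le) fun j => ?_
    have hlate (l : ℕ) : μ (f^[N (j + 1)] ⁻¹' (B (j + 1 + l))ᶜ) ≤ 2⁻¹ ^ (j + l) := by
      have hk0 : c ^ N (j + 1) ≠ 0 := pow_ne_zero _ hc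
      rw [← ENNReal.mul_le_mul_iff_right hk0
        (ENNReal.pow_ne_top (ne_top_of_le_ne_top ENNReal.one_ne_top hc1))]
      calc _ ≤ μ (B (j + 1 + l))ᶜ := pow_mul_measure_preimage_iterate_le hf hcf _ (hB _).compl
        _ ≤ c ^ N (j + 1 + l) * 2⁻¹ ^ (j + 1 + l) := hGc _ _
        _ ≤ c ^ N (j + 1) * 2⁻¹ ^ (j + l) := by
          refine mul_le_mul'
            (pow_le_pow_right_of_le_one' hc1 (hN.monotone (Nat.le_add_right (j + 1) l)))
            (pow_le_pow_right_of_le_one' (by simp) (by omega))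
    calc μ (f^[N (j + 1)] ⁻¹' (B j ∪ tailCompl B (j + 1)))
        ≤ μ (f^[N (j + 1)] ⁻¹' B j) + μ (f^[N (j + 1)] ⁻¹' tailCompl B (j + 1)) := by
          rw [preimage_union]
          exact measure_union_le _ _
      _ ≤ 2⁻¹ ^ j + 2 * 2⁻¹ ^ j := by
          refine add_le_add ((hGp _ _).trans (hle _ _)) ?_
          rw [tailCompl, preimage_iUnion, ← hgeo j]
          exact (measure_iUnion_le _).trans (ENNReal.tsum_le_tsum hlate)
      _ = 3 * 2⁻¹ ^ j := by ring

end Dynamics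

section Lp

variable {X : Type*} [MeasurableSpace X] {μ : Measure X} {p : ℝ≥0∞}

theorem exists_norm_lt_of_ae_bound_of_support (hp : p ≠ ∞) (C : ℝ) {η : ℝ} (hη : 0 < η) :
    ∃ δ : ℝ≥0∞, 0 < δ ∧ ∀ (x : Lp ℝ p μ) (G : Set X), μ G ≤ δ → (∀ᵐ a ∂μ, |x a| ≤ C) →
      (∀ᵐ a ∂μ, a ∉ G → x a = 0) → ‖x‖ < η := by
  obtain ⟨δ, hδ, h⟩ := exists_eLpNorm_indicator_le (μ := μ) hp C
    (ε := ENNReal.ofReal (η / 2)) (by simpa using hη)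
  refine ⟨δ, by simpa using hδ, fun x G hG hC h0 => ?_⟩
  have hle : eLpNorm x p μ ≤ ENNReal.ofReal (η / 2) := by
    refine (eLpNorm_mono_ae ?_).trans (h G hG)
    filter_upwards [hC, h0] with a ha ha0
    by_cases haG : a ∈ G
    · simpa [haG] using ha.trans (le_abs_self C)
    · simp [haG, ha0 haG]
  have := ENNReal.toReal_mono ENNReal.ofReal_ne_top hle
  rw [ENNReal.toReal_ofReal (by positivity), ← Lp.norm_def] at this
  linarith

theorem exists_measure_half_le_abs_le [Fact (1 ≤ p)] (hp : p ≠ ∞) {ε : ℝ≥0∞} (hε : ε ≠ 0) :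
    ∃ η : ℝ, 0 < η ∧ ∀ x : Lp ℝ p μ, ‖x‖ < η → μ {a | 1 / 2 ≤ |x a|} ≤ ε := by
  have hp0 : p ≠ 0 := (zero_lt_one.trans_le (Fact.out : 1 ≤ p)).ne'
  have hp' : 0 < p.toReal := ENNReal.toReal_pos hp0 hp
  have hlim : Tendsto (fun η : ℝ => (ENNReal.ofReal (1 / 2))⁻¹ ^ p.toReal *
      ENNReal.ofReal η ^ p.toReal) (𝓝[>] 0) (𝓝 0) := by
    have h1 : Tendsto (fun η : ℝ => ENNReal.ofReal η ^ p.toReal) (𝓝[>] 0) (𝓝 0) := by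
      have := ((ENNReal.continuous_rpow_const (y := p.toReal)).comp
        ENNReal.continuous_ofReal).tendsto 0
      simp only [Function.comp_apply, ENNReal.ofReal_zero, ENNReal.zero_rpow_of_pos hp'] at this
      exact this.mono_left nhdsWithin_le_nhds
    simpa using ENNReal.Tendsto.const_mul h1
      (Or.inr (ENNReal.rpow_ne_top_of_nonneg hp'.le (by simp)))
  obtain ⟨η, hη, hη0⟩ :=
    ((hlim.eventually_le_const (pos_iff_ne_zero.2 hε)).and self_mem_nhdsWithin).exists
  refine ⟨η, hη0, fun x hx => ?_⟩
  have hset : {a | 1 / 2 ≤ |x a|} = {a | ENNReal.ofReal (1 / 2) ≤ ‖x a‖ₑ} := by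
    ext a
    rw [mem_ofPred_eq, mem_ofPred_eq, ← ofReal_norm, Real.norm_eq_abs,
      ENNReal.ofReal_le_ofReal_iff (abs_nonneg _)]
  rw [hset]
  refine (meas_ge_le_mul_pow_eLpNorm_enorm μ hp0 hp (Lp.aestronglyMeasurable x)
    (by simp) (by simp)).trans (le_trans ?_ hη)
  gcongr
  rw [← Lp.enorm_def, ← ofReal_norm]
  exact ENNReal.ofReal_le_ofReal hx.le

end Lp

section CompositionOperator

variable {X : Type*} [MeasurableSpace X] {μ : Measure X} {p : ℝ≥0∞} [Fact (1 ≤ p)] {f : X → X}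
  {T : Lp ℝ p μ →L[ℝ] Lp ℝ p μ}

theorem iterate_ae_eq_comp_iterate (hf : Measure.QuasiMeasurePreserving f μ μ)
    (hT : ∀ φ : Lp ℝ p μ, ⇑(T φ) =ᵐ[μ] fun x => φ (f x)) (n : ℕ) (φ : Lp ℝ p μ) :
    ⇑(T^[n] φ) =ᵐ[μ] fun x => φ (f^[n] x) := by
  induction n with
  | zero => simp
  | succ n ih =>
    rw [Function.iterate_succ_apply']
    filter_upwards [hT (T^[n] φ), hf.ae ih] with x hx hx'
    rw [hx, hx', Function.iterate_succ_apply]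

theorem almostExpelling_of_forall_exists_norm_lt [IsFiniteMeasure μ] (hp : p ≠ ∞)
    (hf : Measure.QuasiMeasurePreserving f μ μ)
    (hT : ∀ φ : Lp ℝ p μ, ⇑(T φ) =ᵐ[μ] fun x => φ (f x))
    (h : ∀ η : ℝ, 0 < η → ∃ (n : ℕ) (φ : Lp ℝ p μ),
      ‖φ - Lp.const p μ 1‖ < η ∧ ‖T^[n] φ‖ < η) :
    AlmostExpelling μ f := by
  intro ε hε
  obtain ⟨η, hη, hηε⟩ := exists_measure_half_le_abs_le (μ := μ) hp hε
  obtain ⟨n, φ, h1, h2⟩ := h η hη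
  refine ⟨n, {a | 1 / 2 ≤ |φ a|}, ?_, ?_, ?_⟩
  · exact measurableSet_le measurable_const
      (continuous_abs.measurable.comp (Lp.stronglyMeasurable φ).measurable)
  · refine (measure_mono_ae ?_).trans (hηε _ h1)
    filter_upwards [Lp.coeFn_sub φ (Lp.const p μ 1), Lp.coeFn_const p μ (1 : ℝ)] with a ha ha1 hφ
    change 1 / 2 ≤ |_|
    rw [ha, Pi.sub_apply, ha1]
    simp only [Function.const_apply]
    have hφ' : |φ a| < 1 / 2 := not_le.1 hφ
    rw [abs_sub_comm]
    refine le_trans ?_ (le_abs_self _)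
    linarith [le_abs_self (φ a)]
  · refine (measure_mono_ae ?_).trans (hηε _ h2)
    filter_upwards [iterate_ae_eq_comp_iterate hf hT n φ] with a ha hφ
    change 1 / 2 ≤ |_|
    rw [ha]
    exact hφ

theorem IsExpellingSequence.exists_measurable_function {n : ℕ → ℕ} {B : ℕ → Set X}
    (h : IsExpellingSequence μ f n B) (hf : MeasurableEmbedding f) {u v : X → ℝ}
    (hu : Measurable u) (hv : Measurable v) {C : ℝ} (huC : ∀ x, |u x| ≤ C)
    (hvC : ∀ x, |v x| ≤ C) (J : ℕ) :
    ∃ s : X → ℝ, Measurable s ∧ (∀ x, |s x| ≤ C) ∧ (∀ x ∉ tailCompl B J, s x = u x) ∧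
      ∀ j ≥ J, ∀ x, f^[n j] x ∉ B j ∪ tailCompl B (j + 1) →
        s (f^[n j] x) = if Even j then v x else 0 := by
  classical
  have hfi (k : ℕ) : MeasurableEmbedding f^[k] := by
    induction k with
    | zero => exact MeasurableEmbedding.id
    | succ k ih => exact ih.comp hf
  obtain ⟨w, hw, hwE⟩ := exists_measurable_piecewise
    (fun j => (B j)ᶜ \ tailCompl B (j + 1))
    (fun j => (h.measurableSet j).compl.diff (measurableSet_tailCompl h.measurableSet _))
    (fun j => Function.extend f^[n j] (fun x => if Even j then v x else 0) (fun _ => 0))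
    (fun j => (hfi (n j)).measurable_extend
      (by split_ifs <;> fun_prop) measurable_const)
    (by
      have hdisj : ∀ i j, i < j →
          Disjoint ((B i)ᶜ \ tailCompl B (i + 1)) ((B j)ᶜ \ tailCompl B (j + 1)) := by
        intro i j hij
        rw [Set.disjoint_left]
        exact fun x hx hx' => hx.2 (compl_subset_tailCompl B (Nat.succ_le_of_lt hij) hx'.1)
      intro i j hij x hx
      rcases lt_or_gt_of_ne hij with hlt | hlt
      · exact absurd hx.2 (Set.disjoint_left.1 (hdisj i j hlt) hx.1)
      · exact absurd hx.1 (Set.disjoint_left.1 (hdisj j i hlt) hx.2))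
  refine ⟨(tailCompl B J).piecewise (fun x => max (-C) (min C (w x))) u, ?_, ?_, ?_, ?_⟩
  · exact Measurable.piecewise (measurableSet_tailCompl h.measurableSet J) (by fun_prop) hu
  · intro x
    have hC : 0 ≤ C := (abs_nonneg _).trans (huC x)
    by_cases hx : x ∈ tailCompl B J
    · rw [piecewise_eq_of_mem _ _ _ hx, abs_le]
      exact ⟨le_max_left _ _, max_le (by linarith) (min_le_left _ _)⟩
    · rw [piecewise_eq_of_notMem _ _ _ hx]
      exact huC x
  · exact fun x hx => piecewise_eq_of_notMem _ _ _ hx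
  · intro j hj x hx
    rw [mem_union, not_or] at hx
    have hwx : w (f^[n j] x) = if Even j then v x else 0 := by
      rw [hwE j hx, (hfi (n j)).injective.extend_apply]
    have hwC : |w (f^[n j] x)| ≤ C := by
      rw [hwx]
      split_ifs
      · exact hvC x
      · simpa using (abs_nonneg _).trans (hvC x)
    rw [piecewise_eq_of_mem _ _ _ (compl_subset_tailCompl B hj hx.1), ← hwx,
      min_eq_right (abs_le.1 hwC).2, max_eq_right (abs_le.1 hwC).1]

theorem IsExpellingSequence.exists_oscillating [IsFiniteMeasure μ] (hp : p ≠ ∞) {n : ℕ → ℕ}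
    {B : ℕ → Set X} (h : IsExpellingSequence μ f n B) (hfe : MeasurableEmbedding f)
    (hf : Measure.QuasiMeasurePreserving f μ μ)
    (hT : ∀ φ : Lp ℝ p μ, ⇑(T φ) =ᵐ[μ] fun x => φ (f x))
    (φ ψ : Lp.simpleFunc ℝ p μ) {ε : ℝ} (hε : 0 < ε) :
    ∃ s : Lp ℝ p μ, dist s φ < ε ∧
      Tendsto (fun j => T^[n j] s - if Even j then (ψ : Lp ℝ p μ) else 0) atTop (𝓝 0) := by
  obtain ⟨C₁, hC₁⟩ := (Lp.simpleFunc.toSimpleFunc φ).exists_forall_norm_le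
  obtain ⟨C₂, hC₂⟩ := (Lp.simpleFunc.toSimpleFunc ψ).exists_forall_norm_le
  obtain ⟨C, hC₁', hC₂'⟩ : ∃ C, C₁ ≤ C ∧ C₂ ≤ C := ⟨_, le_max_left _ _, le_max_right _ _⟩
  set u := Lp.simpleFunc.toSimpleFunc φ
  set v := Lp.simpleFunc.toSimpleFunc ψ
  have huC (x : X) : |u x| ≤ C := (hC₁ x).trans hC₁'
  have hvC (x : X) : |v x| ≤ C := (hC₂ x).trans hC₂'
  have hu : u =ᵐ[μ] φ := Lp.simpleFunc.toSimpleFunc_eq_toFun φ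
  have hv : v =ᵐ[μ] ψ := Lp.simpleFunc.toSimpleFunc_eq_toFun ψ
  obtain ⟨δ, hδ, hδε⟩ := exists_norm_lt_of_ae_bound_of_support (μ := μ) hp (2 * C) hε
  obtain ⟨J, hJ⟩ := (h.tendsto_tail.eventually_le_const hδ).exists
  obtain ⟨s, hs, hsC, hsu, hsv⟩ :=
    h.exists_measurable_function hfe u.measurable v.measurable huC hvC J
  have hsp : MemLp s p μ := MemLp.of_bound hs.aestronglyMeasurable C (ae_of_all _ hsC)
  refine ⟨hsp.toLp s, ?_, ?_⟩
  · rw [dist_eq_norm]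
    refine hδε _ (tailCompl B J) hJ ?_ ?_
    · filter_upwards [Lp.coeFn_sub (hsp.toLp s) φ, hsp.coeFn_toLp, hu] with x h1 h2 h3
      rw [h1, Pi.sub_apply, h2, ← h3]
      linarith [abs_sub (s x) (u x), hsC x, huC x]
    · filter_upwards [Lp.coeFn_sub (hsp.toLp s) φ, hsp.coeFn_toLp, hu] with x h1 h2 h3 hx
      rw [h1, Pi.sub_apply, h2, ← h3, hsu x hx, sub_self]
  · rw [Metric.tendsto_nhds]
    intro η hη
    obtain ⟨δ', hδ', hδη⟩ := exists_norm_lt_of_ae_bound_of_support (μ := μ) hp (2 * C) hη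
    filter_upwards [h.tendsto_preimage.eventually_le_const hδ', eventually_ge_atTop J] with j hj hjJ
    rw [dist_zero_right]
    have key : ⇑(T^[n j] (hsp.toLp s) - if Even j then (ψ : Lp ℝ p μ) else 0) =ᵐ[μ]
        fun x => s (f^[n j] x) - if Even j then v x else 0 := by
      have hψ : ⇑(if Even j then (ψ : Lp ℝ p μ) else 0) =ᵐ[μ]
          fun x => if Even j then v x else 0 := by
        split_ifs
        · exact hv.symm
        · exact Lp.coeFn_zero ℝ p μ
      filter_upwards [Lp.coeFn_sub (T^[n j] (hsp.toLp s)) (if Even j then (ψ : Lp ℝ p μ) else 0),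
        iterate_ae_eq_comp_iterate hf hT (n j) (hsp.toLp s),
        (hf.iterate (n j)).ae hsp.coeFn_toLp, hψ] with x h1 h2 h3 h4
      rw [h1, Pi.sub_apply, h2, h3, h4]
    refine hδη _ _ hj ?_ ?_
    · filter_upwards [key] with x hx
      rw [hx]
      have hb : |if Even j then v x else 0| ≤ C := by
        split_ifs
        · exact hvC x
        · simpa using (abs_nonneg _).trans (hvC x)
      linarith [abs_sub (s (f^[n j] x)) (if Even j then v x else 0), hsC (f^[n j] x)]
    · filter_upwards [key] with x hx hxG
      rw [hx, hsv j hjJ x hxG, sub_self]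

end CompositionOperator

section Chaos

variable {E : Type*} [NormedAddCommGroup E] [NormedSpace ℝ E] {T : E →L[ℝ] E} {n : ℕ → ℕ}

theorem tendsto_iterate_even {s ψ : E}
    (h : Tendsto (fun j => T^[n j] s - if Even j then ψ else 0) atTop (𝓝 0)) :
    Tendsto (fun k => T^[n (2 * k)] s) atTop (𝓝 ψ) := by
  rw [← tendsto_sub_nhds_zero_iff]
  refine (h.comp (strictMono_mul_left_of_pos two_pos).tendsto_atTop).congr fun k => ?_
  simp

theorem tendsto_iterate_odd {s ψ : E}
    (h : Tendsto (fun j => T^[n j] s - if Even j then ψ else 0) atTop (𝓝 0)) :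
    Tendsto (fun k => T^[n (2 * k + 1)] s) atTop (𝓝 0) := by
  refine (h.comp ((tendsto_add_atTop_nat 1).comp
    (strictMono_mul_left_of_pos two_pos).tendsto_atTop)).congr fun k => ?_
  simp

theorem transitive_of_oscillating {D : Set E} (hD : Dense D)
    (h : ∀ φ ∈ D, ∀ ψ ∈ D, ∀ ε : ℝ, 0 < ε → ∃ s : E, dist s φ < ε ∧
      Tendsto (fun j => T^[n j] s - if Even j then ψ else 0) atTop (𝓝 0))
    {U V : Set E} (hU : IsOpen U) (hV : IsOpen V) (hUne : U.Nonempty) (hVne : V.Nonempty) :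
    ∃ n : ℕ, ((⇑T)^[n] '' U ∩ V).Nonempty := by
  obtain ⟨φ, hφ, hφU⟩ := hD.exists_mem_open hU hUne
  obtain ⟨ψ, hψ, hψV⟩ := hD.exists_mem_open hV hVne
  obtain ⟨ε, hε, hball⟩ := Metric.isOpen_iff.1 hU φ hφU
  obtain ⟨s, hs, hlim⟩ := h φ hφ ψ hψ ε hε
  obtain ⟨k, hk⟩ := ((tendsto_iterate_even hlim).eventually (hV.mem_nhds hψV)).exists
  exact ⟨n (2 * k), _, mem_image_of_mem _ (hball hs), hk⟩

theorem exists_dense_scrambled_of_oscillating {D : Set E} (hD : Dense D) (hDc : ¬ D.Countable)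
    (hn : Tendsto n atTop atTop)
    (h : ∀ φ ∈ D, ∀ ψ ∈ D, ∀ ε : ℝ, 0 < ε → ∃ s : E, dist s φ < ε ∧
      Tendsto (fun j => T^[n j] s - if Even j then ψ else 0) atTop (𝓝 0)) :
    ∃ S : Set E, Dense S ∧ ¬ S.Countable ∧ ∀ x ∈ S, ∀ y ∈ S, x ≠ y →
      (∀ ε > (0 : ℝ), ∃ᶠ n in atTop, dist ((⇑T)^[n] x) ((⇑T)^[n] y) < ε) ∧
      (∃ ε > (0 : ℝ), ∃ᶠ n in atTop, ε < dist ((⇑T)^[n] x) ((⇑T)^[n] y)) := by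
  have hDinf : Infinite D := infinite_coe_iff.2 fun hfin => hDc hfin.countable
  obtain ⟨e⟩ : Nonempty (D × ℕ ≃ D) := by
    rw [← Cardinal.eq, Cardinal.mk_prod]
    simp
  choose s hs hlim using fun i : D × ℕ =>
    h i.1 i.1.2 (e i) (e i).2 (1 / ((i.2 : ℝ) + 1)) (by positivity)
  have hinj : Function.Injective s := fun i i' hii' => e.injective <| Subtype.ext <|
    tendsto_nhds_unique (tendsto_iterate_even (hlim i)) (hii' ▸ tendsto_iterate_even (hlim i'))
  have heven : Tendsto (fun k => n (2 * k)) atTop atTop :=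
    hn.comp (strictMono_mul_left_of_pos two_pos).tendsto_atTop
  have hodd : Tendsto (fun k => n (2 * k + 1)) atTop atTop :=
    hn.comp ((tendsto_add_atTop_nat 1).comp (strictMono_mul_left_of_pos two_pos).tendsto_atTop)
  refine ⟨range s, ?_, ?_, ?_⟩
  · refine Metric.dense_iff.2 fun x r hr => ?_
    obtain ⟨φ, hφ, hφx⟩ := Metric.dense_iff.1 hD x (r / 2) (half_pos hr)
    obtain ⟨m, hm⟩ := exists_nat_one_div_lt (half_pos hr)
    refine ⟨s (⟨φ, hφx⟩, m), ?_, mem_range_self _⟩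
    have h1 := hs (⟨φ, hφx⟩, m)
    have h2 := dist_triangle (s (⟨φ, hφx⟩, m)) φ x
    rw [Metric.mem_ball] at hφ ⊢
    simp only at h1
    linarith
  · intro hc
    have : Countable (D × ℕ) := by
      rw [← image_univ] at hc
      exact countable_univ_iff.1 (countable_of_injective_of_countable_image hinj.injOn hc)
    exact hDc (countable_coe_iff.1 e.symm.injective.countable)
  · rintro _ ⟨i, rfl⟩ _ ⟨i', rfl⟩ hii'
    have hne : (e i : E) ≠ e i' := fun heq => hii' (by rw [e.injective (Subtype.ext heq)])
    constructor
    · intro ε hε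
      have h0 := (tendsto_iterate_odd (hlim i)).dist (tendsto_iterate_odd (hlim i'))
      rw [dist_self] at h0
      exact hodd.frequently (h0.eventually_lt_const hε).frequently
    · have h0 := (tendsto_iterate_even (hlim i)).dist (tendsto_iterate_even (hlim i'))
      have hpos := dist_pos.2 hne
      exact ⟨_, half_pos hpos,
        heven.frequently (h0.eventually_const_lt (half_lt_self hpos)).frequently⟩

end Chaos

theorem not_countable_simpleFunc {X : Type*} [MeasurableSpace X] {μ : Measure X}
    [IsFiniteMeasure μ] {p : ℝ≥0∞} (hX : μ univ ≠ 0) :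
    ¬ (Lp.simpleFunc ℝ p μ : Set (Lp ℝ p μ)).Countable := by
  intro hc
  have : NeZero μ := ⟨fun h => hX (by simp [h])⟩
  have hinj : Function.Injective (Lp.const p μ : ℝ → Lp ℝ p μ) := by
    intro r r' h
    have h1 := (Lp.coeFn_const p μ r).symm.trans (h ▸ Lp.coeFn_const p μ r')
    exact h1.exists.elim fun _ hx => hx
  have hsub : range (Lp.const p μ : ℝ → Lp ℝ p μ) ⊆ Lp.simpleFunc ℝ p μ := by
    rintro _ ⟨r, rfl⟩
    exact ⟨SimpleFunc.const X r, rfl⟩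
  have hcr := hc.mono hsub
  rw [← image_univ] at hcr
  exact Cardinal.not_countable_real (countable_of_injective_of_countable_image hinj.injOn hcr)

/-- **Proposition 1.** If `μ` is finite and `f` is injective, then the composition
operator `T_f` is densely Li-Yorke chaotic (it admits a dense uncountable scrambled set)
if and only if it is topologically transitive. -/
theorem denselyLiYorke_iff_transitive
    {X : Type*} [MeasurableSpace X] (μ : Measure X) (hX : μ Set.univ ≠ 0)
    [IsFiniteMeasure μ]
    (p : ℝ≥0∞) [Fact (1 ≤ p)] (hp : p ≠ ∞)
    (f : X → X) (hf : Measurable f)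
    (hfim : ∀ B : Set X, MeasurableSet B → MeasurableSet (f '' B))
    (c : ℝ≥0∞) (hc : 0 < c)
    (hcf : ∀ B : Set X, MeasurableSet B → c * μ B ≤ μ (f '' B))
    (hinj : Function.Injective f)
    (T : Lp ℝ p μ →L[ℝ] Lp ℝ p μ)
    (hT : ∀ φ : Lp ℝ p μ, ⇑(T φ) =ᵐ[μ] fun x => φ (f x)) :
    -- densely Li-Yorke chaotic: a dense (uncountable) scrambled set exists
    (∃ S : Set (Lp ℝ p μ), Dense S ∧ ¬ S.Countable ∧ ∀ x ∈ S, ∀ y ∈ S, x ≠ y →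
      (∀ ε > (0 : ℝ), ∃ᶠ n in atTop, dist ((⇑T)^[n] x) ((⇑T)^[n] y) < ε) ∧
      (∃ ε > (0 : ℝ), ∃ᶠ n in atTop, ε < dist ((⇑T)^[n] x) ((⇑T)^[n] y))) ↔
    -- topologically transitive
    (∀ U V : Set (Lp ℝ p μ), IsOpen U → IsOpen V → U.Nonempty → V.Nonempty →
      ∃ n : ℕ, ((⇑T)^[n] '' U ∩ V).Nonempty) := by
  have hfe : MeasurableEmbedding f := ⟨hinj, hf, fun B hB => hfim B hB⟩
  have hc' : min c 1 ≠ 0 := (lt_min hc one_pos).ne'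
  have hcf' (A : Set X) (hA : MeasurableSet A) : min c 1 * μ (f ⁻¹' A) ≤ μ A :=
    calc min c 1 * μ (f ⁻¹' A) ≤ c * μ (f ⁻¹' A) := by gcongr; exact min_le_left _ _
      _ ≤ μ (f '' (f ⁻¹' A)) := hcf _ (hf hA)
      _ ≤ μ A := measure_mono (image_preimage_subset f A)
  have hq := quasiMeasurePreserving_of_mul_measure_preimage_le hf hc' hcf'
  have hD : Dense (Lp.simpleFunc ℝ p μ : Set (Lp ℝ p μ)) := Lp.simpleFunc.dense hp
  have hosc (h : AlmostExpelling μ f) : ∃ n : ℕ → ℕ, Tendsto n atTop atTop ∧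
      ∀ φ ∈ (Lp.simpleFunc ℝ p μ : Set (Lp ℝ p μ)), ∀ ψ ∈ (Lp.simpleFunc ℝ p μ : Set (Lp ℝ p μ)),
        ∀ ε : ℝ, 0 < ε → ∃ s : Lp ℝ p μ, dist s φ < ε ∧
          Tendsto (fun j => T^[n j] s - if Even j then ψ else 0) atTop (𝓝 0) := by
    obtain ⟨n, B, hnB⟩ := h.exists_isExpellingSequence hX hf hc' (min_le_right _ _) hcf'
    exact ⟨n, hnB.tendsto_atTop, fun φ hφ ψ hψ ε hε =>
      hnB.exists_oscillating hp hfe hq hT ⟨φ, hφ⟩ ⟨ψ, hψ⟩ hε⟩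
  constructor
  · rintro ⟨S, hSd, -, hS⟩
    have hexp : AlmostExpelling μ f := by
      refine almostExpelling_of_forall_exists_norm_lt hp hq hT fun η hη => ?_
      have h10 : Lp.const p μ (1 : ℝ) ≠ 0 := by
        intro h
        have : NeZero μ := ⟨fun h => hX (by simp [h])⟩
        have h1 := (Lp.coeFn_const p μ (1 : ℝ)).symm.trans (h ▸ Lp.coeFn_zero ℝ p μ)
        exact h1.exists.elim fun _ hx => one_ne_zero hx
      obtain ⟨δ, hδ, hδη, hδ1⟩ : ∃ δ : ℝ, 0 < δ ∧ 2 * δ ≤ η ∧ 2 * δ ≤ ‖Lp.const p μ (1 : ℝ)‖ :=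
        ⟨min η ‖Lp.const p μ (1 : ℝ)‖ / 2, half_pos (lt_min hη (norm_pos_iff.2 h10)),
          by linarith [min_le_left η ‖Lp.const p μ (1 : ℝ)‖],
          by linarith [min_le_right η ‖Lp.const p μ (1 : ℝ)‖]⟩
      obtain ⟨x, hx, hxS⟩ := Metric.dense_iff.1 hSd (Lp.const p μ (1 : ℝ)) δ hδ
      obtain ⟨y, hy, hyS⟩ := Metric.dense_iff.1 hSd 0 δ hδ
      rw [mem_ball_iff_norm] at hx hy
      rw [sub_zero] at hy
      have hxy : ‖x - y - Lp.const p μ (1 : ℝ)‖ < 2 * δ := by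
        rw [sub_right_comm]
        linarith [norm_sub_le (x - Lp.const p μ (1 : ℝ)) y]
      have hne : x ≠ y := by
        rintro rfl
        rw [sub_self, zero_sub, norm_neg] at hxy
        linarith
      obtain ⟨n, hn⟩ := ((hS x hxS y hyS hne).1 η hη).exists
      refine ⟨n, x - y, hxy.trans_le hδη, ?_⟩
      rwa [iterate_map_sub, ← dist_eq_norm]
    obtain ⟨n, -, h⟩ := hosc hexp
    exact fun U V hU hV hUne hVne => transitive_of_oscillating hD h hU hV hUne hVne
  · intro htrans
    have hexp : AlmostExpelling μ f := by
      refine almostExpelling_of_forall_exists_norm_lt hp hq hT fun η hη => ?_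
      obtain ⟨n, _, ⟨φ, hφ, rfl⟩, hφn⟩ := htrans (Metric.ball (Lp.const p μ (1 : ℝ)) η)
        (Metric.ball 0 η) Metric.isOpen_ball Metric.isOpen_ball
        (Metric.nonempty_ball.2 hη) (Metric.nonempty_ball.2 hη)
      exact ⟨n, φ, mem_ball_iff_norm.1 hφ, mem_ball_zero_iff.1 hφn⟩
    obtain ⟨n, hn, h⟩ := hosc hexp
    exact exists_dense_scrambled_of_oscillating hD (not_countable_simpleFunc hX) hn h
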